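/- If X is a metric space with strong measure zero and Y is a metric space with sharp measure zero, then X × Y with the maximum metric has strong measure zero. -/

import Mathlib

open MeasureTheory Set Filter Pointwise
open scoped ENNReal NNReal Topology

/-- A gauge: a nondecreasing, right-continuous function `h : [0,∞) → [0,∞]` with `h 0 = 0`
and `h r > 0` for `r > 0`. -/
def IsGauge (h : ℝ≥0∞ → ℝ≥0∞) : Prop :=
  Monotone h ∧ (∀ r : ℝ≥0∞, Filter.Tendsto h (nhdsWithin r (Set.Ioi r)) (nhds (h r))) ∧
    h 0 = 0 ∧ ∀ r : ℝ≥0∞, 0 < r → 0 < h r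

/-- `X` has strong measure zero: for every sequence of positive reals `ε n` there is a
countable cover `U n` of `X` with `diam (U n) ≤ ε n` for all `n`. -/
def HasSMZ (X : Type*) [MetricSpace X] : Prop :=
  ∀ ε : ℕ → ℝ, (∀ n, 0 < ε n) →
    ∃ U : ℕ → Set X, (∀ x : X, ∃ n, x ∈ U n) ∧
      ∀ n, EMetric.diam (U n) ≤ ENNReal.ofReal (ε n)

/-- `⟨U n⟩` is a γ-groupable cover of `E`: there is a strictly increasing sequence
`0 = k 0 < k 1 < ⋯` such that every `x ∈ E` belongs to `⋃_{k j ≤ n < k (j+1)} U n`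
for all but finitely many `j`. -/
def IsGammaGroupable {X : Type*} (U : ℕ → Set X) (E : Set X) : Prop :=
  ∃ k : ℕ → ℕ, k 0 = 0 ∧ StrictMono k ∧
    ∀ x ∈ E, ∀ᶠ j in Filter.atTop, ∃ n, k j ≤ n ∧ n < k (j + 1) ∧ x ∈ U n

/-- A set `E` in a metric space has sharp measure zero: for every sequence of positive reals
`ε n` it admits a γ-groupable cover `U n` with `diam (U n) ≤ ε n` for all `n`. -/
def IsSSMZ {X : Type*} [MetricSpace X] (E : Set X) : Prop :=
  ∀ ε : ℕ → ℝ, (∀ n, 0 < ε n) →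
    ∃ U : ℕ → Set X, IsGammaGroupable U E ∧
      ∀ n, EMetric.diam (U n) ≤ ENNReal.ofReal (ε n)

/-- A metric space has sharp measure zero. -/
def HasSSMZ (X : Type*) [MetricSpace X] : Prop := IsSSMZ (Set.univ : Set X)

/-- Finitely many terms of a positive sequence have a positive lower bound. -/
lemma exists_pos_forall_lt_le (ε : ℕ → ℝ) (hε : ∀ n, 0 < ε n) (N : ℕ) :
    ∃ δ : ℝ, 0 < δ ∧ ∀ n < N, δ ≤ ε n := by
  induction N with
  | zero => exact ⟨1, one_pos, by simp⟩
  | succ N ih =>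
    obtain ⟨δ, hδ, h⟩ := ih
    refine ⟨min δ (ε N), lt_min hδ (hε N), fun n hn => ?_⟩
    rcases Nat.lt_succ_iff_lt_or_eq.mp hn with hn | rfl
    · exact (min_le_left _ _).trans (h n hn)
    · exact min_le_right _ _

/-- In a space of strong measure zero the covers can be chosen so that every point is covered
infinitely often. -/
lemma HasSMZ.exists_frequently_mem {X : Type*} [MetricSpace X] (hX : HasSMZ X)
    (ε : ℕ → ℝ) (hε : ∀ n, 0 < ε n) :
    ∃ U : ℕ → Set X, (∀ x : X, ∃ᶠ n in atTop, x ∈ U n) ∧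
      ∀ n, Metric.ediam (U n) ≤ ENNReal.ofReal (ε n) := by
  choose U hU hd using fun i : ℕ => hX (fun m => ε (Nat.pair i m)) (fun m => hε _)
  refine ⟨fun n => U n.unpair.1 n.unpair.2, fun x => ?_, fun n => ?_⟩
  · rw [frequently_atTop]
    intro i
    obtain ⟨m, hm⟩ := hU i x
    exact ⟨Nat.pair i m, Nat.left_le_pair i m, by simpa using hm⟩
  · have h := hd n.unpair.1 n.unpair.2
    rwa [Nat.pair_unpair] at h

/-- If `X` has strong measure zero and `Y` has sharp measure zero, then `X × Y` with the
maximum metric has strong measure zero. -/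
theorem stmt8 (X Y : Type) [MetricSpace X] [MetricSpace Y]
    (hX : HasSMZ X) (hY : HasSSMZ Y) : HasSMZ (X × Y) := by
  intro ε hε
  obtain ⟨V, ⟨k, -, hk, hV⟩, hVd⟩ := hY ε hε
  choose δ hδ hδε using fun j => exists_pos_forall_lt_le ε hε (k (j + 1))
  obtain ⟨U, hU, hUd⟩ := hX.exists_frequently_mem δ hδ
  refine ⟨fun n => {p | ∃ j, k j ≤ n ∧ n < k (j + 1) ∧ p.1 ∈ U j ∧ p.2 ∈ V n}, ?_, ?_⟩
  · rintro ⟨x, y⟩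
    obtain ⟨j, hx, n, h₁, h₂, hy⟩ := ((hU x).and_eventually (hV y (mem_univ y))).exists
    exact ⟨n, j, h₁, h₂, hx, hy⟩
  · intro n
    refine Metric.ediam_le ?_
    rintro p ⟨i, hi, hi', hpU, hpV⟩ q ⟨j, hj, hj', hqU, hqV⟩
    have hij : i = j := by
      have h₁ := hk.lt_iff_lt.mp (hi.trans_lt hj')
      have h₂ := hk.lt_iff_lt.mp (hj.trans_lt hi')
      omega
    subst hij
    rw [Prod.edist_eq]
    refine max_le ?_ ((Metric.edist_le_ediam_of_mem hpV hqV).trans (hVd n))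
    exact (Metric.edist_le_ediam_of_mem hpU hqU).trans
      ((hUd i).trans (ENNReal.ofReal_le_ofReal (hδε i n hi')))
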